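/- arXiv:1305.1613 — 3 statements merged into one kernel-verified Lean document; each statement's English description precedes it below -/
import Mathlib

section
/- Let G be a finite quiver with edge set E. Suppose x ∈ ℤ^E has nonnegative coordinates, satisfies flow conservation at every vertex v (that is, Σ_{e : ι(e)=v} x_e = Σ_{e : τ(e)=v} x_e), and the subgraph of the underlying undirected graph consisting of the edges e with x_e > 0 together with their endpoints is connected. Then there exists a closed directed path (circuit) in G that traverses each edge e exactly x_e times. -/
noncomputable section

variable {V E : Type*}

/-- `p` is a directed path in the quiver with source map `ι` and target map `τ`. -/
def IsDPath (ι τ : E → V) (p : List E) : Prop :=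
  List.Chain' (fun a b => τ a = ι b) p

/-- `p` is a circuit: a directed path whose initial and terminal vertices coincide. -/
def IsCircuit (ι τ : E → V) (p : List E) : Prop :=
  IsDPath ι τ p ∧ ∀ h : p ≠ [], ι (p.head h) = τ (p.getLast h)

/-- The vertices touched by an edge of positive multiplicity in `x`. -/
def suppVertices (ι τ : E → V) (x : E → ℤ) : Set V :=
  {v | ∃ e, 0 < x e ∧ (ι e = v ∨ τ e = v)}

/-- One-step adjacency in the underlying undirected graph of the support of `x`. -/
def suppAdj (ι τ : E → V) (x : E → ℤ) (u v : V) : Prop :=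
  ∃ e, 0 < x e ∧ ((ι e = u ∧ τ e = v) ∨ (ι e = v ∧ τ e = u))

/-- Along a nonempty directed path, departures and arrivals at a vertex differ only through the
endpoints of the path. -/
theorem IsDPath.countP_balance [DecidableEq V] {ι τ : E → V} :
    ∀ {p : List E}, IsDPath ι τ p → ∀ (h : p ≠ []) (v : V),
      p.countP (ι · = v) + (if τ (p.getLast h) = v then 1 else 0) =
        p.countP (τ · = v) + (if ι (p.head h) = v then 1 else 0)
  | [], _, h, _ => absurd rfl h
  | [a], _, _, v => by
    by_cases h₁ : ι a = v <;> by_cases h₂ : τ a = v <;> simp [h₁, h₂]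
  | a :: b :: l, hp, _, v => by
    have hp' : τ a = ι b ∧ IsDPath ι τ (b :: l) := List.isChain_cons_cons.1 hp
    have ih := hp'.2.countP_balance (List.cons_ne_nil b l) v
    rw [List.countP_cons (a := a), List.countP_cons (a := a)]
    simp only [List.head_cons, ← hp'.1, List.getLast_cons_cons, decide_eq_true_eq] at ih ⊢
    by_cases h₁ : ι a = v <;> by_cases h₂ : τ a = v <;>
      by_cases h₃ : τ ((b :: l).getLast (List.cons_ne_nil b l)) = v <;>
      simp only [h₁, h₂, h₃, if_true, if_false] at ih ⊢ <;> omega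

theorem sum_filter_count_eq_countP [Fintype E] [DecidableEq E] (P : E → Prop) [DecidablePred P]
    (p : List E) : ∑ e ∈ Finset.univ.filter P, p.count e = p.countP (P ·) := by
  induction p with
  | nil => simp
  | cons a l ih =>
    simp only [List.count_cons, List.countP_cons, Finset.sum_add_distrib, ih]
    simp [Finset.sum_ite_eq]

/-- A circuit can be rotated so as to start with any prescribed one of its edges. -/
theorem IsCircuit.exists_perm_cons {ι τ : E → V} {p : List E} (hp : IsCircuit ι τ p) {e : E}
    (he : e ∈ p) : ∃ l : List E, (e :: l).Perm p ∧ IsCircuit ι τ (e :: l) := by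
  obtain ⟨a, b, rfl⟩ := List.append_of_mem he
  refine ⟨b ++ a, List.perm_append_comm (l₁ := e :: b), ?_⟩
  obtain ⟨hchain, hclosed⟩ := hp
  rcases a.eq_nil_or_concat with rfl | ⟨a', z, rfl⟩
  · rw [List.append_nil]
    exact ⟨hchain, hclosed⟩
  · have hsplit := List.isChain_append.1 hchain
    have hc := hclosed (by simp)
    refine ⟨(List.isChain_append (l₁ := e :: b)).2 ⟨hsplit.2.1, hsplit.1, ?_⟩, fun _ => ?_⟩
    · intro s hs t ht
      rw [List.getLast?_eq_some_getLast (List.cons_ne_nil e b), Option.mem_some_iff] at hs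
      rw [List.head?_eq_some_head (by simp), Option.mem_some_iff] at ht
      subst hs ht
      simpa [List.getLast_append, List.head_append] using hc.symm
    · simpa using (hsplit.2.2 z (by simp) e (by simp)).symm

/-- The terminal vertex of any edge of a circuit is the initial vertex of an edge of the circuit. -/
theorem IsCircuit.exists_mem_source_eq_target [DecidableEq V] {ι τ : E → V} {p : List E}
    (hp : IsCircuit ι τ p) {e : E} (he : e ∈ p) : ∃ f ∈ p, ι f = τ e := by
  have hne := List.ne_nil_of_mem he
  have hb := hp.1.countP_balance hne (τ e)
  rw [hp.2 hne, add_left_inj] at hb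
  have hpos : 0 < p.countP (τ · = τ e) := List.countP_pos_iff.2 ⟨e, he, by simp⟩
  rw [← hb] at hpos
  obtain ⟨f, hf, hfe⟩ := List.countP_pos_iff.1 hpos
  exact ⟨f, hf, of_decide_eq_true hfe⟩

/-- If a directed path bounded by a flow is not closed, the flow has an unused edge leaving its
terminal vertex. -/
theorem IsDPath.exists_unused_edge [Fintype E] [DecidableEq V] [DecidableEq E]
    {ι τ : E → V} {x : E → ℤ} {p : List E} (hp : IsDPath ι τ p) (h : p ≠ [])
    (hle : ∀ e, (p.count e : ℤ) ≤ x e)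
    (hflow : ∀ v : V, ∑ e ∈ Finset.univ.filter (fun e => ι e = v), x e
                    = ∑ e ∈ Finset.univ.filter (fun e => τ e = v), x e)
    (hopen : ι (p.head h) ≠ τ (p.getLast h)) :
    ∃ e, ι e = τ (p.getLast h) ∧ (p.count e : ℤ) < x e := by
  by_contra! hno
  have hb := hp.countP_balance h (τ (p.getLast h))
  rw [if_pos rfl, if_neg hopen, ← sum_filter_count_eq_countP, ← sum_filter_count_eq_countP] at hb
  have hout : ∑ e ∈ Finset.univ.filter (fun e => ι e = τ (p.getLast h)), x e ≤
      ∑ e ∈ Finset.univ.filter (fun e => ι e = τ (p.getLast h)), (p.count e : ℤ) :=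
    Finset.sum_le_sum fun e he => hno e (Finset.mem_filter.1 he).2
  have hin : ∑ e ∈ Finset.univ.filter (fun e => τ e = τ (p.getLast h)), (p.count e : ℤ) ≤
      ∑ e ∈ Finset.univ.filter (fun e => τ e = τ (p.getLast h)), x e :=
    Finset.sum_le_sum fun e _ => hle e
  rw [hflow] at hout
  zify at hb
  linarith

/-- If a nonempty circuit bounded by `x` misses part of the connected support of `x`, then some
unused edge touches a vertex of the circuit. -/
theorem IsCircuit.exists_unused_edge_touching [DecidableEq V] [DecidableEq E]
    {ι τ : E → V} {x : E → ℤ} {p : List E} (hp : IsCircuit ι τ p) (h : p ≠ [])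
    (hle : ∀ e, (p.count e : ℤ) ≤ x e)
    (hconn : ∀ u ∈ suppVertices ι τ x, ∀ v ∈ suppVertices ι τ x,
      Relation.ReflTransGen (suppAdj ι τ x) u v)
    {f : E} (hf : (p.count f : ℤ) < x f) :
    ∃ e, (p.count e : ℤ) < x e ∧ ∃ g ∈ p, ι g = ι e ∨ ι g = τ e := by
  by_contra! hno
  obtain ⟨g, hg⟩ := List.exists_mem_of_ne_nil p h
  have hxg : 0 < x g := lt_of_lt_of_le (by exact_mod_cast List.count_pos_iff.2 hg) (hle g)
  have hxf : 0 < x f := lt_of_le_of_lt (by positivity) hf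
  have hmem : ∀ e, 0 < x e → ∀ k ∈ p, (ι k = ι e ∨ ι k = τ e) → e ∈ p := by
    intro e hxe k hk hke
    by_contra hep
    have := hno e (by rwa [List.count_eq_zero.2 hep, Nat.cast_zero]) k hk
    tauto
  have hreach : ∀ v, Relation.ReflTransGen (suppAdj ι τ x) (ι g) v → ∃ k ∈ p, ι k = v := by
    intro v hv
    induction hv with
    | refl => exact ⟨g, hg, rfl⟩
    | tail _ hadj ih =>
      obtain ⟨k, hk, rfl⟩ := ih
      obtain ⟨e, hxe, ⟨h₁, rfl⟩ | ⟨rfl, h₂⟩⟩ := hadj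
      · exact hp.exists_mem_source_eq_target (hmem e hxe k hk (.inl h₁.symm))
      · exact ⟨e, hmem e hxe k hk (.inr h₂.symm), rfl⟩
  obtain ⟨k, hk, hkf⟩ := hreach (ι f) (hconn _ ⟨g, hxg, .inl rfl⟩ _ ⟨f, hxf, .inl rfl⟩)
  exact (hno f hf k hk).1 hkf

/-- Among the directed paths using each edge at most `x e` times there is a longest one. -/
theorem exists_longest_isDPath [Fintype E] [DecidableEq E] (ι τ : E → V) {x : E → ℤ}
    (hnonneg : ∀ e, 0 ≤ x e) :
    ∃ p : List E, IsDPath ι τ p ∧ (∀ e, (p.count e : ℤ) ≤ x e) ∧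
      ∀ q : List E, IsDPath ι τ q → (∀ e, (q.count e : ℤ) ≤ x e) → q.length ≤ p.length := by
  let S : Set ℕ := {n | ∃ p : List E, IsDPath ι τ p ∧ (∀ e, (p.count e : ℤ) ≤ x e) ∧ p.length = n}
  have hne : S.Nonempty := ⟨0, [], List.isChain_nil, by simpa using hnonneg, rfl⟩
  have hbdd : BddAbove S := by
    refine ⟨(∑ e, x e).toNat, ?_⟩
    rintro _ ⟨p, -, hle, rfl⟩
    have hlen := sum_filter_count_eq_countP (fun _ : E => True) p
    simp only [Finset.filter_true, decide_true, List.countP_true] at hlen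
    rw [← hlen]
    have := Finset.sum_le_sum fun e (_ : e ∈ Finset.univ) => hle e
    push_cast [← Nat.cast_sum] at this
    omega
  obtain ⟨p, hp, hle, hlen⟩ := Nat.sSup_mem hne hbdd
  exact ⟨p, hp, hle, fun q hq hqle => hlen ▸ le_csSup hbdd ⟨q, hq, hqle, rfl⟩⟩

/-- **Eulerian circuits for conservative connected flows.** Let `G` be a finite
quiver and let `x ∈ ℤ^E` be nonnegative, satisfy flow conservation at every
vertex, and have connected support (as a subgraph of the underlying undirected
graph). Then there is a circuit traversing each edge `e` exactly `x e` times. -/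
theorem exists_circuit_of_flow [Fintype V] [Fintype E] [DecidableEq V] [DecidableEq E]
    (ι τ : E → V) (x : E → ℤ)
    (hnonneg : ∀ e, 0 ≤ x e)
    (hflow : ∀ v : V, ∑ e ∈ Finset.univ.filter (fun e => ι e = v), x e
                    = ∑ e ∈ Finset.univ.filter (fun e => τ e = v), x e)
    (hconn : ∀ u ∈ suppVertices ι τ x, ∀ v ∈ suppVertices ι τ x,
      Relation.ReflTransGen (suppAdj ι τ x) u v) :
    ∃ p : List E, IsCircuit ι τ p ∧ ∀ e : E, (p.count e : ℤ) = x e := by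
  obtain ⟨p, hp, hle, hmax⟩ := exists_longest_isDPath ι τ hnonneg
  have hextend : ∀ e (q r : List E), (p.count e : ℤ) < x e → q.Perm p → r.Perm (e :: q) →
      ¬ IsDPath ι τ r := by
    intro e q r he hq hr hpath
    have hrp : r.Perm (e :: p) := hr.trans (hq.cons e)
    have := hmax r hpath fun f => by
      rw [hrp.count_eq, List.count_cons]
      rcases eq_or_ne e f with rfl | hef
      · simp; omega
      · simpa [hef] using hle f
    simp [hrp.length_eq] at this
  have hcirc : IsCircuit ι τ p := by
    refine ⟨hp, fun h => ?_⟩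
    by_contra hopen
    obtain ⟨e, hι, he⟩ := hp.exists_unused_edge h hle hflow hopen
    refine hextend e p (p ++ [e]) he (.refl _) (List.perm_append_singleton e p) ?_
    refine List.isChain_append.2 ⟨hp, List.isChain_singleton e, ?_⟩
    simp [List.getLast?_eq_some_getLast h, hι]
  refine ⟨p, hcirc, fun e => (hle e).eq_of_not_lt fun he => ?_⟩
  rcases eq_or_ne p [] with rfl | hne
  · exact hextend e [] [e] he (.refl _) (.refl _) (List.isChain_singleton e)
  obtain ⟨f, hf, g, hg, hgf⟩ := hcirc.exists_unused_edge_touching hne hle hconn he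
  obtain ⟨l, hl, hlc⟩ := hcirc.exists_perm_cons hg
  rcases hgf with hgf | hgf
  · refine hextend f (g :: l) (g :: l ++ [f]) hf hl (List.perm_append_singleton f _) ?_
    refine List.isChain_append.2 ⟨hlc.1, List.isChain_singleton f, ?_⟩
    have hclosed := hlc.2 (List.cons_ne_nil g l)
    rw [List.head_cons, hgf] at hclosed
    simp [List.getLast?_eq_some_getLast (List.cons_ne_nil g l), hclosed]
  · exact hextend f (g :: l) (f :: g :: l) hf hl (.refl _)
      (List.isChain_cons_cons.2 ⟨hgf.symm, hlc.1⟩)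
end
end

section
/- Let G be a finite quiver with a distinguished vertex v₀, and let φ be a graph map of G with φ_V(v₀) = v₀ such that φ_ab(ĉ) = ĉ for every closed path c in Sym G. Then there exists a function L′ assigning to each edge e ∈ E a finite subset L′(e) ⊆ ℝ^E such that for every path p in Sym G with initial vertex v₀, HP(φ(p)) = ⋃_{x ∈ HP(p)} ( x + L′(e(x)) ). -/
open Filter MeasureTheory

noncomputable section

variable {V E : Type*}

/-- The initial vertex of a signed edge (an edge traversed forwards or backwards). -/
def symStart (ι τ : E → V) (s : E × Bool) : V := if s.2 then ι s.1 else τ s.1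

/-- The terminal vertex of a signed edge. -/
def symEnd (ι τ : E → V) (s : E × Bool) : V := if s.2 then τ s.1 else ι s.1

/-- `p` is a path in the symmetrification `Sym G` of the quiver with source map `ι`
and target map `τ`: each edge may be traversed forwards or backwards, and the
terminal vertex of each signed edge equals the initial vertex of the next. -/
def IsSymPath (ι τ : E → V) (p : List (E × Bool)) : Prop :=
  List.Chain' (fun a b => symEnd ι τ a = symStart ι τ b) p

/-- The signed step vector `±e_f ∈ ℝ^E` of a signed edge. -/
def stepVecE [DecidableEq E] (s : E × Bool) : EuclideanSpace ℝ E :=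
  EuclideanSpace.single s.1 (if s.2 then (1 : ℝ) else -1)

/-- The partial sum `v_j ∈ ℝ^E` of the first `j` signed step vectors of a path. -/
def symPartial [DecidableEq E] (p : List (E × Bool)) (j : ℕ) : EuclideanSpace ℝ E :=
  ((p.take j).map stepVecE).sum

/-- The signed traversal vector `p̂ ∈ ℝ^E` of a path in `Sym G`. -/
def symVec [DecidableEq E] (p : List (E × Bool)) : EuclideanSpace ℝ E :=
  (p.map stepVecE).sum

/-- The shadow of a path in `Sym G`: the union of the segments `[v_{j-1}, v_j]`
between consecutive partial sums. -/
def symShd [DecidableEq E] (p : List (E × Bool)) : Set (EuclideanSpace ℝ E) :=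
  ⋃ j ∈ Finset.range p.length, segment ℝ (symPartial p j) (symPartial p (j + 1))

/-- `c` is a closed path (its initial and terminal vertices coincide). -/
def IsClosedSymPath (ι τ : E → V) (c : List (E × Bool)) : Prop :=
  IsSymPath ι τ c ∧ ∀ h : c ≠ [], symStart ι τ (c.head h) = symEnd ι τ (c.getLast h)

/-- The set `ℋ ⊆ ℝ^E` of half-points: exactly one coordinate lies in `ℤ + 1/2`
and all other coordinates are integers. -/
def halfSet [DecidableEq E] : Set (EuclideanSpace ℝ E) :=
  {x | ∃ e₀ : E, (∃ m : ℤ, x e₀ = (m : ℝ) + 1 / 2) ∧ ∀ e ≠ e₀, ∃ m : ℤ, x e = (m : ℝ)}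

/-- The half-point set `HP(p) = shd(p) ∩ ℋ` of a path in `Sym G`. -/
def HP [DecidableEq E] (p : List (E × Bool)) : Set (EuclideanSpace ℝ E) :=
  symShd p ∩ halfSet

/-- The reversal of a path in `Sym G`. -/
def symReverse (p : List (E × Bool)) : List (E × Bool) :=
  (p.map fun s => (s.1, !s.2)).reverse

/-- The image of a path in `Sym G` under a graph map with edge assignment `φE`:
a forwards-traversed edge `e` is sent to `φE e` and a backwards-traversed edge is
sent to the reversal of `φE e`, and the results are concatenated. -/
def mapPath (φE : E → List (E × Bool)) (p : List (E × Bool)) : List (E × Bool) :=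
  (p.map fun s => if s.2 then φE s.1 else symReverse (φE s.1)).flatten

/-- The induced linear map `φ_ab : ℝ^E → ℝ^E` of a graph map, sending the basis
vector `e_e` to the signed traversal vector of `φE e`. -/
def phiAb [DecidableEq E] [Fintype E] (φE : E → List (E × Bool))
    (x : EuclideanSpace ℝ E) : EuclideanSpace ℝ E :=
  ∑ e : E, x e • symVec (φE e)

section Paths

/-- `p` is a path from `a` to `b` in the symmetrification; the empty path joins a vertex to itself. -/
def IsSymPathBetween (ι τ : E → V) : V → V → List (E × Bool) → Prop
  | a, b, [] => a = b
  | a, b, s :: p => symStart ι τ s = a ∧ IsSymPathBetween ι τ (symEnd ι τ s) b p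

variable {ι τ : E → V} {a b c : V} {p q : List (E × Bool)}

theorem isSymPathBetween_append :
    IsSymPathBetween ι τ a c (p ++ q) ↔
      ∃ b, IsSymPathBetween ι τ a b p ∧ IsSymPathBetween ι τ b c q := by
  induction p generalizing a with
  | nil => simp [IsSymPathBetween]
  | cons s p ih => simp [IsSymPathBetween, ih, and_assoc]

theorem symReverse_cons (s : E × Bool) (p : List (E × Bool)) :
    symReverse (s :: p) = symReverse p ++ [(s.1, !s.2)] := by
  simp [symReverse]

theorem symReverse_append (p q : List (E × Bool)) :
    symReverse (p ++ q) = symReverse q ++ symReverse p := by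
  simp [symReverse]

theorem symReverse_symReverse (p : List (E × Bool)) : symReverse (symReverse p) = p := by
  simp [symReverse, List.map_reverse, Function.comp_def]

theorem IsSymPathBetween.symReverse (h : IsSymPathBetween ι τ a b p) :
    IsSymPathBetween ι τ b a (symReverse p) := by
  induction p generalizing a with
  | nil => exact Eq.symm h
  | cons s p ih =>
    rw [symReverse_cons, isSymPathBetween_append]
    refine ⟨_, ih h.2, ?_⟩
    rcases s with ⟨e, _ | _⟩ <;>
      simpa [IsSymPathBetween, symStart, symEnd] using h.1

theorem IsSymPathBetween.start_head (h : IsSymPathBetween ι τ a b p) (hp : p ≠ []) :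
    symStart ι τ (p.head hp) = a := by
  cases p with
  | nil => exact absurd rfl hp
  | cons s p => exact h.1

theorem IsSymPathBetween.end_getLast (h : IsSymPathBetween ι τ a b p) (hp : p ≠ []) :
    symEnd ι τ (p.getLast hp) = b := by
  induction p generalizing a with
  | nil => exact absurd rfl hp
  | cons s p ih =>
    rcases eq_or_ne p [] with rfl | hne
    · exact h.2
    · rw [List.getLast_cons hne]
      exact ih h.2 hne

theorem IsSymPathBetween.isSymPath (h : IsSymPathBetween ι τ a b p) : IsSymPath ι τ p := by
  induction p generalizing a with
  | nil => exact List.IsChain.nil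
  | cons s p ih =>
    refine List.IsChain.cons (ih h.2) fun t ht => ?_
    cases p with
    | nil => simp at ht
    | cons u p =>
      obtain rfl : u = t := by simpa using ht
      exact h.2.1.symm

theorem IsSymPathBetween.isClosedSymPath (h : IsSymPathBetween ι τ a a p) :
    IsClosedSymPath ι τ p :=
  ⟨h.isSymPath, fun hp => (h.start_head hp).trans (h.end_getLast hp).symm⟩

theorem IsSymPath.exists_isSymPathBetween (h : IsSymPath ι τ p)
    (ha : ∀ hp : p ≠ [], symStart ι τ (p.head hp) = a) : ∃ b, IsSymPathBetween ι τ a b p := by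
  induction p generalizing a with
  | nil => exact ⟨a, rfl⟩
  | cons s p ih =>
    obtain ⟨b, hb⟩ := ih (a := symEnd ι τ s) (List.IsChain.tail h) fun hp => by
      cases p with
      | nil => exact absurd rfl hp
      | cons t p => exact (List.isChain_cons_cons.1 h).1.symm
    exact ⟨b, ha (List.cons_ne_nil _ _), hb⟩

theorem mapPath_cons (φE : E → List (E × Bool)) (s : E × Bool) (p : List (E × Bool)) :
    mapPath φE (s :: p) = mapPath φE [s] ++ mapPath φE p := by
  simp [mapPath]

end Paths

section HalfPoints

variable [DecidableEq E]

theorem symVec_append (p q : List (E × Bool)) : symVec (p ++ q) = symVec p + symVec q := by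
  simp [symVec]

theorem symVec_cons (s : E × Bool) (p : List (E × Bool)) :
    symVec (s :: p) = stepVecE s + symVec p := by
  simp [symVec]

theorem stepVecE_not (e : E) (b : Bool) : stepVecE (e, !b) = -stepVecE (e, b) := by
  ext i
  by_cases h : i = e <;> cases b <;> simp [stepVecE, h]

theorem symVec_symReverse (p : List (E × Bool)) : symVec (symReverse p) = -symVec p := by
  induction p with
  | nil => simp [symVec, symReverse]
  | cons s p ih =>
    rw [symReverse_cons, symVec_append, ih, symVec_cons, symVec_cons, stepVecE_not]
    simp [symVec]

theorem exists_int_stepVecE (s : E × Bool) (e : E) : ∃ m : ℤ, stepVecE s e = m := by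
  rcases s with ⟨f, b⟩
  by_cases h : e = f
  · cases b
    · exact ⟨-1, by simp [stepVecE, h]⟩
    · exact ⟨1, by simp [stepVecE, h]⟩
  · exact ⟨0, by simp [stepVecE, h]⟩

theorem exists_int_symVec (p : List (E × Bool)) (e : E) : ∃ m : ℤ, symVec p e = m := by
  induction p with
  | nil => exact ⟨0, by simp [symVec]⟩
  | cons s p ih =>
    obtain ⟨m, hm⟩ := ih
    obtain ⟨n, hn⟩ := exists_int_stepVecE s e
    exact ⟨n + m, by simp [symVec_cons, hm, hn]⟩

theorem intCast_ne_intCast_add_half (m n : ℤ) : (m : ℝ) ≠ n + 1 / 2 := by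
  intro h
  have h' : ((2 * m : ℤ) : ℝ) = ((2 * n + 1 : ℤ) : ℝ) := by push_cast; linarith
  have := Int.cast_injective h'
  omega

/-- On a unit segment of the integer grid, a parameter gives a half-integer coordinate
only at the midpoint. -/
theorem eq_half_of_add_mul_eq {t σ : ℝ} {m n : ℤ} (h0 : 0 ≤ t) (h1 : t ≤ 1)
    (hσ : σ = 1 ∨ σ = -1) (h : (n : ℝ) + t * σ = m + 1 / 2) : t = 1 / 2 := by
  rcases hσ with rfl | rfl
  · have l1 : ((m - n : ℤ) : ℝ) < ((1 : ℤ) : ℝ) := by push_cast; linarith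
    have l2 : ((-1 : ℤ) : ℝ) < ((m - n : ℤ) : ℝ) := by push_cast; linarith
    have : m = n := by
      have := Int.cast_lt.1 l1
      have := Int.cast_lt.1 l2
      omega
    subst this
    linarith
  · have l1 : ((n - m : ℤ) : ℝ) < ((2 : ℤ) : ℝ) := by push_cast; linarith
    have l2 : ((0 : ℤ) : ℝ) < ((n - m : ℤ) : ℝ) := by push_cast; linarith
    have : n = m + 1 := by
      have := Int.cast_lt.1 l1
      have := Int.cast_lt.1 l2
      omega
    subst this
    push_cast at h
    linarith

theorem stepVecE_self (s : E × Bool) : stepVecE s s.1 = 1 ∨ stepVecE s s.1 = -1 := by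
  rcases s with ⟨e, _ | _⟩ <;> simp [stepVecE]

theorem stepVecE_of_ne (s : E × Bool) {e : E} (h : e ≠ s.1) : stepVecE s e = 0 := by
  simp [stepVecE, h]

theorem midpoint_apply_self (p : List (E × Bool)) (s : E × Bool) :
    ∃ m : ℤ, (symVec p + (1 / 2 : ℝ) • stepVecE s) s.1 = m + 1 / 2 := by
  obtain ⟨n, hn⟩ := exists_int_symVec p s.1
  rcases stepVecE_self s with h | h
  · exact ⟨n, by simp [hn, h]⟩
  · exact ⟨n - 1, by simp [hn, h]; ring⟩

theorem midpoint_apply_of_ne (p : List (E × Bool)) (s : E × Bool) {e : E} (h : e ≠ s.1) :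
    ∃ m : ℤ, (symVec p + (1 / 2 : ℝ) • stepVecE s) e = m := by
  obtain ⟨n, hn⟩ := exists_int_symVec p e
  exact ⟨n, by simp [hn, stepVecE_of_ne s h]⟩

theorem eq_of_midpoint_apply {p : List (E × Bool)} {s : E × Bool} {e : E} {m : ℤ}
    (h : (symVec p + (1 / 2 : ℝ) • stepVecE s) e = m + 1 / 2) : e = s.1 := by
  by_contra hne
  obtain ⟨n, hn⟩ := midpoint_apply_of_ne p s hne
  exact intCast_ne_intCast_add_half n m (hn ▸ h)

theorem mem_segment_inter_halfSet {p : List (E × Bool)} {s : E × Bool} {x : EuclideanSpace ℝ E} :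
    x ∈ segment ℝ (symVec p) (symVec p + stepVecE s) ∩ halfSet ↔
      x = symVec p + (1 / 2 : ℝ) • stepVecE s := by
  rw [segment_eq_image']
  constructor
  · rintro ⟨⟨t, ⟨h0, h1⟩, rfl⟩, e, ⟨m, hm⟩, -⟩
    obtain ⟨n, hn⟩ := exists_int_symVec p e
    simp only [add_sub_cancel_left, PiLp.add_apply, PiLp.smul_apply, smul_eq_mul, hn] at hm ⊢
    by_cases he : e = s.1
    · subst he
      rw [eq_half_of_add_mul_eq h0 h1 (stepVecE_self s) hm]
    · rw [stepVecE_of_ne s he, mul_zero, add_zero] at hm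
      exact absurd hm (intCast_ne_intCast_add_half n m)
  · rintro rfl
    exact ⟨⟨1 / 2, by norm_num, by simp⟩, s.1, midpoint_apply_self p s,
      fun e he => midpoint_apply_of_ne p s he⟩

/-- The half-points of a path are the midpoints of its steps. -/
theorem mem_HP_iff {p : List (E × Bool)} {x : EuclideanSpace ℝ E} :
    x ∈ HP p ↔ ∃ l s r, p = l ++ s :: r ∧ x = symVec l + (1 / 2 : ℝ) • stepVecE s := by
  have hstep : ∀ (l : List (E × Bool)) s r,
      symPartial (l ++ s :: r) l.length = symVec l ∧
        symPartial (l ++ s :: r) (l.length + 1) = symVec l + stepVecE s := by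
    intro l s r
    constructor
    · simp [symPartial, symVec]
    · simp [symPartial, symVec, List.take_append, List.take_of_length_le]
  constructor
  · rintro ⟨hx, hh⟩
    simp only [symShd, Set.mem_iUnion, Finset.mem_range] at hx
    obtain ⟨j, hj, hx⟩ := hx
    have hp : p = p.take j ++ p[j] :: p.drop (j + 1) := by simp
    have hlen : (p.take j).length = j := by simp; omega
    obtain ⟨h1, h2⟩ := hstep (p.take j) p[j] (p.drop (j + 1))
    rw [← hp, hlen] at h1 h2
    rw [h1, h2] at hx
    exact ⟨_, _, _, hp, mem_segment_inter_halfSet.1 ⟨hx, hh⟩⟩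
  · rintro ⟨l, s, r, rfl, hx⟩
    obtain ⟨hx, hh⟩ := mem_segment_inter_halfSet.2 hx
    refine ⟨?_, hh⟩
    simp only [symShd, Set.mem_iUnion, Finset.mem_range]
    refine ⟨l.length, by simp, ?_⟩
    rwa [(hstep l s r).1, (hstep l s r).2]

theorem HP_finite (p : List (E × Bool)) : (HP p).Finite := by
  refine ((p.inits.product p).map
    fun t => symVec t.1 + (1 / 2 : ℝ) • stepVecE t.2).finite_toSet.subset fun x hx => ?_
  obtain ⟨l, s, r, rfl, rfl⟩ := mem_HP_iff.1 hx
  refine List.mem_map.2 ⟨(l, s), List.mem_product.2 ⟨?_, by simp⟩, rfl⟩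
  simp

theorem HP_nil : HP ([] : List (E × Bool)) = ∅ := by
  simp [HP, symShd]

theorem mem_HP_append {p q : List (E × Bool)} {x : EuclideanSpace ℝ E} :
    x ∈ HP (p ++ q) ↔ x ∈ HP p ∨ x - symVec p ∈ HP q := by
  simp only [mem_HP_iff]
  constructor
  · rintro ⟨l, s, r, h, rfl⟩
    rcases List.append_eq_append_iff.1 h with ⟨m, rfl, hq⟩ | ⟨m, rfl, hm⟩
    · exact Or.inr ⟨m, s, r, hq, by rw [symVec_append]; abel⟩
    · cases m with
      | nil => exact Or.inr ⟨[], s, r, hm.symm, by simp [symVec]⟩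
      | cons t m =>
        obtain ⟨rfl, -⟩ := List.cons.inj hm
        exact Or.inl ⟨l, s, m, rfl, rfl⟩
  · rintro (⟨l, s, r, rfl, rfl⟩ | ⟨l, s, r, rfl, h⟩)
    · exact ⟨l, s, r ++ q, by simp, rfl⟩
    · refine ⟨p ++ l, s, r, by simp, ?_⟩
      rw [symVec_append, add_assoc, ← h, add_sub_cancel]

theorem add_symVec_mem_HP_of_mem_symReverse {p : List (E × Bool)} {x : EuclideanSpace ℝ E}
    (hx : x ∈ HP (symReverse p)) : x + symVec p ∈ HP p := by
  obtain ⟨l, s, r, h, rfl⟩ := mem_HP_iff.1 hx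
  have hp : p = symReverse r ++ (s.1, !s.2) :: symReverse l := by
    rw [← symReverse_symReverse p, h, symReverse_append, symReverse_cons]
    simp
  refine mem_HP_iff.2 ⟨_, _, _, hp, ?_⟩
  rw [hp, symVec_append, symVec_cons, symVec_symReverse l, stepVecE_not]
  module

theorem mem_HP_symReverse {p : List (E × Bool)} {x : EuclideanSpace ℝ E} :
    x ∈ HP (symReverse p) ↔ x + symVec p ∈ HP p := by
  refine ⟨add_symVec_mem_HP_of_mem_symReverse, fun h => ?_⟩
  rw [← symReverse_symReverse p] at h
  simpa [symReverse_symReverse, symVec_symReverse] using add_symVec_mem_HP_of_mem_symReverse h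

theorem mem_HP_mapPath {φE : E → List (E × Bool)} {p : List (E × Bool)}
    {y : EuclideanSpace ℝ E} :
    y ∈ HP (mapPath φE p) ↔
      ∃ l s r, p = l ++ s :: r ∧ y - symVec (mapPath φE l) ∈ HP (mapPath φE [s]) := by
  induction p generalizing y with
  | nil => simp [mapPath, HP_nil]
  | cons t p ih =>
    rw [mapPath_cons, mem_HP_append, ih]
    constructor
    · rintro (h | ⟨l, s, r, rfl, h⟩)
      · exact ⟨[], t, p, rfl, by simpa [mapPath, symVec] using h⟩
      · refine ⟨t :: l, s, r, rfl, ?_⟩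
        rwa [mapPath_cons φE _ l, symVec_append, ← sub_sub]
    · rintro ⟨l, s, r, h, hy⟩
      cases l with
      | nil =>
        obtain ⟨rfl, -⟩ := List.cons.inj h
        exact Or.inl (by simpa [mapPath, symVec] using hy)
      | cons u l =>
        obtain ⟨rfl, rfl⟩ := List.cons.inj h
        refine Or.inr ⟨l, s, r, rfl, ?_⟩
        rwa [mapPath_cons φE _ l, symVec_append, ← sub_sub] at hy

variable [Fintype E]

theorem phiAb_add (φE : E → List (E × Bool)) (x y : EuclideanSpace ℝ E) :
    phiAb φE (x + y) = phiAb φE x + phiAb φE y := by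
  simp [phiAb, add_smul, Finset.sum_add_distrib]

theorem phiAb_neg (φE : E → List (E × Bool)) (x : EuclideanSpace ℝ E) :
    phiAb φE (-x) = -phiAb φE x := by
  simp [phiAb]

theorem phiAb_stepVecE (φE : E → List (E × Bool)) (s : E × Bool) :
    phiAb φE (stepVecE s) = symVec (mapPath φE [s]) := by
  have hsum : phiAb φE (stepVecE s) = stepVecE s s.1 • symVec (φE s.1) :=
    Finset.sum_eq_single s.1 (fun e _ he => by rw [stepVecE_of_ne s he, zero_smul])
      fun h => absurd (Finset.mem_univ _) h
  rw [hsum]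
  rcases s with ⟨e, _ | _⟩ <;> simp [stepVecE, mapPath, symVec_symReverse]

theorem symVec_mapPath (φE : E → List (E × Bool)) (p : List (E × Bool)) :
    symVec (mapPath φE p) = phiAb φE (symVec p) := by
  induction p with
  | nil => simp [mapPath, symVec, phiAb]
  | cons s p ih =>
    rw [mapPath_cons, symVec_append, ih, symVec_cons, phiAb_add, phiAb_stepVecE]

/-- If `φ_ab` fixes the vectors of closed paths, the displacement `φ_ab(p̂) - p̂` depends only on
the endpoints of `p`. -/
theorem phiAb_symVec_sub_eq {ι τ : E → V} {φE : E → List (E × Bool)}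
    (hab : ∀ c : List (E × Bool), IsClosedSymPath ι τ c → phiAb φE (symVec c) = symVec c)
    {a b : V} {p q : List (E × Bool)} (hp : IsSymPathBetween ι τ a b p)
    (hq : IsSymPathBetween ι τ a b q) :
    phiAb φE (symVec p) - symVec p = phiAb φE (symVec q) - symVec q := by
  have h := hab _ (isSymPathBetween_append.2 ⟨b, hp, hq.symReverse⟩).isClosedSymPath
  rw [symVec_append, symVec_symReverse, phiAb_add, phiAb_neg, ← sub_eq_add_neg,
    ← sub_eq_add_neg] at h
  rwa [sub_eq_sub_iff_sub_eq_sub]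

theorem exists_displacement {ι τ : E → V} {φE : E → List (E × Bool)}
    (hab : ∀ c : List (E × Bool), IsClosedSymPath ι τ c → phiAb φE (symVec c) = symVec c)
    (a : V) : ∃ δ : V → EuclideanSpace ℝ E, ∀ b p, IsSymPathBetween ι τ a b p →
      phiAb φE (symVec p) = symVec p + δ b := by
  have h : ∀ b, ∃ d : EuclideanSpace ℝ E, ∀ p, IsSymPathBetween ι τ a b p →
      phiAb φE (symVec p) = symVec p + d := by
    intro b
    by_cases hb : ∃ q, IsSymPathBetween ι τ a b q
    · obtain ⟨q, hq⟩ := hb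
      exact ⟨phiAb φE (symVec q) - symVec q, fun p hp => by
        rw [← phiAb_symVec_sub_eq hab hp hq, add_sub_cancel]⟩
    · exact ⟨0, fun p hp => absurd ⟨p, hp⟩ hb⟩
  choose δ hδ using h
  exact ⟨δ, hδ⟩

/-- The half-points contributed by the image of one step, relative to the midpoint of that step,
do not depend on the direction in which the step is traversed. -/
theorem mem_HP_mapPath_singleton {ι τ : E → V} {φE : E → List (E × Bool)} {a : V}
    {δ : V → EuclideanSpace ℝ E}
    (hδ : ∀ b p, IsSymPathBetween ι τ a b p → phiAb φE (symVec p) = symVec p + δ b)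
    {l : List (E × Bool)} {s : E × Bool} {b : V} (hl : IsSymPathBetween ι τ a b l)
    (hs : symStart ι τ s = b) (y : EuclideanSpace ℝ E) :
    y - symVec (mapPath φE l) ∈ HP (mapPath φE [s]) ↔
      y - (symVec l + (1 / 2 : ℝ) • stepVecE s) + (1 / 2 : ℝ) • stepVecE (s.1, true) - δ (ι s.1)
        ∈ HP (φE s.1) := by
  have hsb : IsSymPathBetween ι τ b (symEnd ι τ s) [s] := ⟨hs, rfl⟩
  have hls := hδ _ _ (isSymPathBetween_append.2 ⟨b, hl, hsb⟩)
  rw [symVec_append, phiAb_add, hδ _ _ hl] at hls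
  rw [symVec_mapPath, hδ _ _ hl]
  rcases s with ⟨e, _ | _⟩
  · have hneg : stepVecE (e, false) = -stepVecE (e, true) := stepVecE_not e true
    have hφ : phiAb φE (symVec [(e, false)]) = -symVec (φE e) := by
      rw [← symVec_mapPath]
      simp [mapPath, symVec_symReverse]
    rw [hφ] at hls
    have hmap : mapPath φE [(e, false)] = symReverse (φE e) := by simp [mapPath]
    rw [hmap, mem_HP_symReverse]
    have hvec : symVec [(e, false)] = -stepVecE (e, true) := by simp [symVec, hneg]
    have hend : symEnd ι τ (e, false) = ι e := rfl
    rw [hvec, hend] at hls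
    have hval : symVec (φE e) = stepVecE (e, true) + δ b - δ (ι e) := by
      linear_combination (norm := module) (-1 : ℝ) • hls
    rw [hval, hneg]
    convert Iff.rfl using 2
    module
  · obtain rfl : ι e = b := hs
    have hmap : mapPath φE [(e, true)] = φE e := by simp [mapPath]
    rw [hmap]
    convert Iff.rfl using 2
    module

end HalfPoints

/-- **Locality of half-point sets.** Let `φ` be a graph map of a finite quiver `G`
fixing a vertex `v₀` and acting trivially on the vectors of closed paths of `Sym G`.
Then there is a function `L′` assigning to each edge a finite subset of `ℝ^E` such
that for every path `p` in `Sym G` starting at `v₀`,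
`HP(φ(p)) = ⋃_{x ∈ HP(p)} (x + L′(e(x)))`, where `e(x)` is the edge indexing the
half-integer coordinate of `x`. -/
theorem halfPoint_locality [Fintype V] [Fintype E] [DecidableEq E]
    (ι τ : E → V) (v₀ : V) (φV : V → V) (φE : E → List (E × Bool))
    (hpath : ∀ e, IsSymPath ι τ (φE e))
    (hends : ∀ e (h : φE e ≠ []),
      symStart ι τ ((φE e).head h) = φV (ι e) ∧ symEnd ι τ ((φE e).getLast h) = φV (τ e))
    (hv₀ : φV v₀ = v₀)
    (hab : ∀ c : List (E × Bool), IsClosedSymPath ι τ c → phiAb φE (symVec c) = symVec c) :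
    ∃ L' : E → Set (EuclideanSpace ℝ E), (∀ e, (L' e).Finite) ∧
      ∀ p : List (E × Bool), IsSymPath ι τ p →
        (∀ h : p ≠ [], symStart ι τ (p.head h) = v₀) →
        HP (mapPath φE p) =
          {y | ∃ x ∈ HP p, ∃ e₀ : E, (∃ m : ℤ, x e₀ = (m : ℝ) + 1 / 2) ∧
            ∃ u ∈ L' e₀, y = x + u} := by
  obtain ⟨δ, hδ⟩ := exists_displacement hab v₀
  refine ⟨fun e => {u | u + (1 / 2 : ℝ) • stepVecE (e, true) - δ (ι e) ∈ HP (φE e)},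
    fun e => ?_, fun p hp hstart => ?_⟩
  · refine (HP_finite (φE e)).preimage (Function.Injective.injOn fun u v huv => ?_)
    exact add_right_cancel (sub_left_injective huv)
  obtain ⟨w, hw⟩ := hp.exists_isSymPathBetween hstart
  have hstep : ∀ l s r, p = l ++ s :: r → ∀ y, y - symVec (mapPath φE l) ∈ HP (mapPath φE [s]) ↔
      y - (symVec l + (1 / 2 : ℝ) • stepVecE s) + (1 / 2 : ℝ) • stepVecE (s.1, true) - δ (ι s.1)
        ∈ HP (φE s.1) := by
    rintro l s r rfl y
    obtain ⟨b, hl, hs, -⟩ := isSymPathBetween_append.1 hw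
    exact mem_HP_mapPath_singleton hδ hl hs y
  ext y
  rw [mem_HP_mapPath]
  constructor
  · rintro ⟨l, s, r, h, hy⟩
    exact ⟨_, mem_HP_iff.2 ⟨l, s, r, h, rfl⟩, s.1, midpoint_apply_self l s, _,
      (hstep l s r h y).1 hy, (add_sub_cancel _ _).symm⟩
  · rintro ⟨x, hx, e, ⟨m, hm⟩, u, hu, rfl⟩
    obtain ⟨l, s, r, h, rfl⟩ := mem_HP_iff.1 hx
    obtain rfl := eq_of_midpoint_apply hm
    refine ⟨l, s, r, h, (hstep l s r h _).2 ?_⟩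
    rwa [add_sub_cancel_left]
end
end

section
/- Let G be a finite quiver with edge set E and a length function l : E → (0,∞), let Q ∈ ℝ^E, and let (p_k)_{k≥1} be a sequence of nonempty paths in Sym G such that the union ⋃_k (1/k)·shd(p_k) is a bounded subset of ℝ^E. If the scaled half-point darkness measures drk_kHP^l(p_k) converge weak-* to δ_Q as k → ∞, then the scaled darkness measures drk_k^l(p_k) converge weak-* to δ_Q. -/
open Filter MeasureTheory

noncomputable section

variable {V E : Type*}

/-- The total length `l(p)` of a path in `Sym G` with respect to a length
function `l` on the edges. -/
def symLen (l : E → ℝ) (p : List (E × Bool)) : ℝ :=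
  (p.map fun s => l s.1).sum

/-- The uniform probability measure on the segment from `a` to `b`: the
pushforward of Lebesgue measure on `[0,1]` under `t ↦ a + t•(b-a)`. -/
def segMeasureE [Fintype E] (a b : EuclideanSpace ℝ E) : Measure (EuclideanSpace ℝ E) :=
  Measure.map (fun t : ℝ => a + t • (b - a)) ((volume : Measure ℝ).restrict (Set.Icc 0 1))

/-- The darkness `drk^l(p)` of a path in `Sym G`: the pushforward of Lebesgue
measure on `[0,1]` under the parametrized shadow of `p`, i.e. the convex
combination, with weight `l(f_j)/l(p)`, of the uniform measures on the segments
`[v_{j-1}, v_j]` of the shadow. -/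
def drkQ [Fintype E] [DecidableEq E] (l : E → ℝ) (p : List (E × Bool)) :
    Measure (EuclideanSpace ℝ E) :=
  ∑ j ∈ Finset.range p.length,
    ENNReal.ofReal (((p.map fun s => l s.1).getD j 0) / symLen l p) •
      segMeasureE (symPartial p j) (symPartial p (j + 1))

/-- The scaled darkness `drk_k^l(p)`: the pushforward of `drk^l(p)` under `x ↦ x/k`. -/
def drkQk [Fintype E] [DecidableEq E] (l : E → ℝ) (k : ℕ) (p : List (E × Bool)) :
    Measure (EuclideanSpace ℝ E) :=
  Measure.map (fun x : EuclideanSpace ℝ E => (k : ℝ)⁻¹ • x) (drkQ l p)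

/-- The half-point darkness `drkHP^l(p)`: the atomic measure putting mass
`l(f_j)/l(p)` at the midpoint of each segment `[v_{j-1}, v_j]` of the shadow,
so that each `x ∈ HP(p)` carries mass `c_x·l(e(x))/l(p)`. -/
def drkHP [Fintype E] [DecidableEq E] (l : E → ℝ) (p : List (E × Bool)) :
    Measure (EuclideanSpace ℝ E) :=
  ∑ j ∈ Finset.range p.length,
    ENNReal.ofReal (((p.map fun s => l s.1).getD j 0) / symLen l p) •
      Measure.dirac (midpoint ℝ (symPartial p j) (symPartial p (j + 1)))

/-- The scaled half-point darkness `drk_kHP^l(p)`. -/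
def drkHPk [Fintype E] [DecidableEq E] (l : E → ℝ) (k : ℕ) (p : List (E × Bool)) :
    Measure (EuclideanSpace ℝ E) :=
  Measure.map (fun x : EuclideanSpace ℝ E => (k : ℝ)⁻¹ • x) (drkHP l p)

/-- Weak-* convergence of a sequence of measures: integrals of every bounded
continuous real function converge. -/
def WeakStarTendsto {X : Type*} [MeasurableSpace X] [TopologicalSpace X]
    (μ : ℕ → Measure X) (ν : Measure X) : Prop :=
  ∀ h : X → ℝ, Continuous h → (∃ M : ℝ, ∀ x, |h x| ≤ M) →
    Tendsto (fun k => ∫ x, h x ∂(μ k)) atTop (nhds (∫ x, h x ∂ν))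

lemma norm_stepVecE [Fintype E] [DecidableEq E] (s : E × Bool) : ‖stepVecE s‖ = 1 := by
  rw [stepVecE, EuclideanSpace.single, PiLp.norm_single]
  split_ifs <;> simp

lemma symPartial_succ [DecidableEq E] (p : List (E × Bool)) {j : ℕ} (hj : j < p.length) :
    symPartial p (j + 1) = symPartial p j + stepVecE p[j] := by
  rw [symPartial, symPartial, ← List.take_concat_get' p j hj, List.map_append, List.sum_append]
  simp

lemma sum_getD_range (L : List ℝ) : ∑ j ∈ Finset.range L.length, L.getD j 0 = L.sum := by
  induction L with
  | nil => simp
  | cons a L ih =>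
    rw [List.length_cons, Finset.sum_range_succ', List.sum_cons, ← ih, add_comm]
    simp

/-- The weight `l(f_j)/l(p)` carried by the `j`-th segment of the shadow of `p`. -/
def segWeight (l : E → ℝ) (p : List (E × Bool)) (j : ℕ) : ℝ :=
  ((p.map fun s => l s.1).getD j 0) / symLen l p

lemma symLen_pos {l : E → ℝ} (hl : ∀ e, 0 < l e) {p : List (E × Bool)} (hp : p ≠ []) :
    0 < symLen l p := by
  refine List.sum_pos _ ?_ (by simpa using hp)
  intro x hx
  obtain ⟨s, -, rfl⟩ := List.mem_map.1 hx
  exact hl _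

lemma segWeight_nonneg {l : E → ℝ} (hl : ∀ e, 0 < l e) {p : List (E × Bool)} (hp : p ≠ [])
    (j : ℕ) : 0 ≤ segWeight l p j := by
  refine div_nonneg ?_ (symLen_pos hl hp).le
  rw [List.getD_eq_getElem?_getD, List.getElem?_map]
  cases p[j]? with
  | none => simp
  | some s => exact (hl s.1).le

lemma sum_segWeight {l : E → ℝ} (hl : ∀ e, 0 < l e) {p : List (E × Bool)} (hp : p ≠ []) :
    ∑ j ∈ Finset.range p.length, segWeight l p j = 1 := by
  have h := sum_getD_range (p.map fun s => l s.1)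
  rw [List.length_map] at h
  simp_rw [segWeight]
  rw [← Finset.sum_div, h]
  exact div_self (symLen_pos hl hp).ne'

lemma integral_map_smul_sum [Fintype E] {ι : Type*} (s : Finset ι) (w : ι → ℝ)
    (hw : ∀ j, 0 ≤ w j) (μ : ι → Measure (EuclideanSpace ℝ E)) [∀ j, IsFiniteMeasure (μ j)]
    (c : ℝ) {h : EuclideanSpace ℝ E → ℝ} (hc : Continuous h) {M : ℝ} (hM : ∀ x, |h x| ≤ M) :
    ∫ x, h x ∂(Measure.map (fun x => c • x) (∑ j ∈ s, ENNReal.ofReal (w j) • μ j)) =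
      ∑ j ∈ s, w j * ∫ x, h (c • x) ∂(μ j) := by
  have hc' : Continuous fun x : EuclideanSpace ℝ E => h (c • x) := by fun_prop
  rw [integral_map (by fun_prop) hc.aestronglyMeasurable, integral_finsetSum_measure]
  · refine Finset.sum_congr rfl fun j _ => ?_
    rw [integral_smul_measure, ENNReal.toReal_ofReal (hw j), smul_eq_mul]
  · intro j _
    refine Integrable.smul_measure ?_ ENNReal.ofReal_ne_top
    exact Integrable.of_bound hc'.aestronglyMeasurable M (ae_of_all _ fun x => hM _)

instance isProbabilityMeasure_segMeasureE [Fintype E] (a b : EuclideanSpace ℝ E) :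
    IsProbabilityMeasure (segMeasureE a b) := by
  have : IsProbabilityMeasure ((volume : Measure ℝ).restrict (Set.Icc 0 1)) := ⟨by simp⟩
  exact Measure.isProbabilityMeasure_map (by fun_prop)

lemma ae_mem_segment_segMeasureE [Fintype E] (a b : EuclideanSpace ℝ E) :
    ∀ᵐ x ∂(segMeasureE a b), x ∈ segment ℝ a b := by
  have hclosed : IsClosed (segment ℝ a b) := by
    rw [segment_eq_image']
    exact (isCompact_Icc.image (by fun_prop)).isClosed
  rw [segMeasureE, ae_map_iff (p := (· ∈ segment ℝ a b)) (by fun_prop)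
    hclosed.measurableSet]
  filter_upwards [ae_restrict_mem measurableSet_Icc] with t ht
  rw [segment_eq_image']
  exact ⟨t, ht, rfl⟩

lemma dist_le_of_mem_segment {F : Type*} [NormedAddCommGroup F] [NormedSpace ℝ F] {a b x y : F}
    (hx : x ∈ segment ℝ a b) (hy : y ∈ segment ℝ a b) : dist x y ≤ dist a b := by
  rw [← convexHull_pair] at hx hy
  calc dist x y ≤ Metric.diam (convexHull ℝ {a, b}) :=
        Metric.dist_le_diam_of_mem (isBounded_convexHull.2 (Set.toFinite _).isBounded) hx hy
    _ = dist a b := by rw [convexHull_diam, Metric.diam_pair]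

/-- If `h` oscillates by at most `ε` on each scaled segment of the shadow, its integrals against
the scaled darkness and half-point darkness differ by at most `ε`. -/
lemma abs_integral_drkQk_sub_integral_drkHPk_le [Fintype E] [DecidableEq E] {l : E → ℝ}
    (hl : ∀ e, 0 < l e) (k : ℕ) {p : List (E × Bool)} (hp : p ≠ [])
    {h : EuclideanSpace ℝ E → ℝ} (hc : Continuous h) {M : ℝ} (hM : ∀ x, |h x| ≤ M) {ε : ℝ}
    (hosc : ∀ j < p.length, ∀ x ∈ segment ℝ (symPartial p j) (symPartial p (j + 1)),
      ∀ y ∈ segment ℝ (symPartial p j) (symPartial p (j + 1)),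
        |h ((k : ℝ)⁻¹ • x) - h ((k : ℝ)⁻¹ • y)| ≤ ε) :
    |(∫ x, h x ∂(drkQk l k p)) - ∫ x, h x ∂(drkHPk l k p)| ≤ ε := by
  have hw := segWeight_nonneg hl hp
  have hQ : ∫ x, h x ∂(drkQk l k p) = _ := integral_map_smul_sum (Finset.range p.length)
    (segWeight l p) hw
    (fun j => segMeasureE (symPartial p j) (symPartial p (j + 1))) (k : ℝ)⁻¹ hc hM
  have hHP : ∫ x, h x ∂(drkHPk l k p) = _ := integral_map_smul_sum (Finset.range p.length)
    (segWeight l p) hw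
    (fun j => Measure.dirac (midpoint ℝ (symPartial p j) (symPartial p (j + 1)))) (k : ℝ)⁻¹ hc hM
  rw [hQ, hHP, ← Finset.sum_sub_distrib]
  calc _ ≤ ∑ j ∈ Finset.range p.length, segWeight l p j * ε := by
        refine (Finset.abs_sum_le_sum_abs _ _).trans (Finset.sum_le_sum fun j hj => ?_)
        rw [← mul_sub, abs_mul, abs_of_nonneg (hw j)]
        refine mul_le_mul_of_nonneg_left ?_ (hw j)
        set m := midpoint ℝ (symPartial p j) (symPartial p (j + 1))
        set μ := segMeasureE (symPartial p j) (symPartial p (j + 1))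
        have hint : Integrable (fun x => h ((k : ℝ)⁻¹ • x)) μ :=
          Integrable.of_bound (Continuous.aestronglyMeasurable (by fun_prop)) M
            (ae_of_all _ fun x => hM _)
        have hconst : ∫ x, h ((k : ℝ)⁻¹ • x) ∂(Measure.dirac m) = ∫ _, h ((k : ℝ)⁻¹ • m) ∂μ := by
          simp
        rw [hconst, ← integral_sub hint (integrable_const _)]
        have hμ : ε * μ.real Set.univ = ε := by rw [probReal_univ, mul_one]
        rw [← Real.norm_eq_abs, ← hμ]
        refine norm_integral_le_of_norm_le_const ?_
        filter_upwards [ae_mem_segment_segMeasureE (symPartial p j) (symPartial p (j + 1))]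
          with x hx
        exact hosc j (Finset.mem_range.1 hj) x hx m (midpoint_mem_segment _ _)
    _ = ε := by rw [← Finset.sum_mul, sum_segWeight hl hp, one_mul]

/-- **Half-point darkness controls darkness.** Let `G` be a finite quiver with a
positive length function `l` and let `(p_k)` be a sequence of nonempty paths in
`Sym G` whose scaled shadows `(1/k)·shd(p_k)` are uniformly bounded. If the scaled
half-point darkness measures `drk_kHP^l(p_k)` converge weak-* to `δ_Q`, then the
scaled darkness measures `drk_k^l(p_k)` converge weak-* to `δ_Q`. -/
theorem darkness_of_halfpoint_darkness [Fintype V] [Fintype E] [DecidableEq E]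
    (ι τ : E → V) (l : E → ℝ) (hl : ∀ e, 0 < l e)
    (Q : EuclideanSpace ℝ E) (p : ℕ → List (E × Bool))
    (hpath : ∀ k, IsSymPath ι τ (p k)) (hne : ∀ k, p k ≠ [])
    (hbdd : Bornology.IsBounded
      (⋃ k : ℕ, (fun x : EuclideanSpace ℝ E => (k : ℝ)⁻¹ • x) '' symShd (p k)))
    (hHP : WeakStarTendsto (fun k => drkHPk l k (p k)) (Measure.dirac Q)) :
    WeakStarTendsto (fun k => drkQk l k (p k)) (Measure.dirac Q) := by
  intro h hc hb
  obtain ⟨M, hM⟩ := hb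
  have hcomp : IsCompact (closure
      (⋃ k : ℕ, (fun x : EuclideanSpace ℝ E => (k : ℝ)⁻¹ • x) '' symShd (p k))) :=
    hbdd.isCompact_closure
  have huc := hcomp.uniformContinuousOn_of_continuous hc.continuousOn
  have hdiff : Tendsto (fun k => (∫ x, h x ∂(drkQk l k (p k))) - ∫ x, h x ∂(drkHPk l k (p k)))
      atTop (nhds 0) := by
    rw [Metric.tendsto_atTop]
    intro ε hε
    obtain ⟨δ, hδ, hosc⟩ := Metric.uniformContinuousOn_iff.1 huc (ε / 2) (half_pos hε)
    obtain ⟨N, hN⟩ := exists_nat_one_div_lt hδ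
    refine ⟨N + 1, fun k hk => ?_⟩
    have hkδ : (k : ℝ)⁻¹ < δ := by
      refine lt_of_le_of_lt ?_ hN
      rw [one_div]
      exact inv_anti₀ (by positivity) (by exact_mod_cast hk)
    rw [Real.dist_eq, sub_zero]
    refine lt_of_le_of_lt (abs_integral_drkQk_sub_integral_drkHPk_le hl k (hne k) hc hM
      (ε := ε / 2) fun j hj x hx y hy => ?_) (half_lt_self hε)
    have hmem : ∀ z ∈ segment ℝ (symPartial (p k) j) (symPartial (p k) (j + 1)),
        (k : ℝ)⁻¹ • z ∈ closure
          (⋃ k : ℕ, (fun x : EuclideanSpace ℝ E => (k : ℝ)⁻¹ • x) '' symShd (p k)) :=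
      fun z hz => subset_closure (Set.mem_iUnion.2 ⟨k, z,
        Set.mem_biUnion (Finset.mem_coe.2 (Finset.mem_range.2 hj)) hz, rfl⟩)
    refine (hosc _ (hmem x hx) _ (hmem y hy) ?_).le
    have hxy : dist x y ≤ 1 := by
      refine (dist_le_of_mem_segment hx hy).trans_eq ?_
      rw [symPartial_succ _ hj, dist_self_add_right, norm_stepVecE]
    rw [dist_smul₀, norm_inv, RCLike.norm_natCast]
    exact (mul_le_of_le_one_right (by positivity) hxy).trans_lt hkδ
  simpa using hdiff.add (hHP h hc ⟨M, hM⟩)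
end
end
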